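/- arXiv:1904.12345 — 3 statements merged into one kernel-verified Lean document; each statement's English description precedes it below -/
import Mathlib

section
/- Let c > 0 and let g(x) = e^{−cx²} be a scaled centered Gaussian, and let Λ ⊆ ℝ² be a lattice with density d(Λ) < 1. Then 𝔍(𝒢(g, Λ)) = Λ; that is, a time-frequency shift π(a,b) leaves 𝒢(g,Λ) invariant if and only if (a,b) ∈ Λ. -/
open MeasureTheory Complex Filter
open scoped ENNReal InnerProductSpace RealInnerProductSpace ComplexConjugate

noncomputable section

/-- The Hilbert space `L²(ℝ)` of complex-valued square-integrable functions. -/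
abbrev L2 : Type := Lp ℂ 2 (volume : Measure ℝ)

lemma memLp_translate (a : ℝ) (f : L2) :
    MemLp (fun x : ℝ => f (x - a)) 2 (volume : Measure ℝ) :=
  (Lp.memLp f).comp_measurePreserving (measurePreserving_sub_right volume a)

lemma memLp_modulate (b : ℝ) (f : L2) :
    MemLp (fun x : ℝ => Complex.exp (2 * Real.pi * Complex.I * (b * x)) * f x) 2
      (volume : Measure ℝ) := by
  refine MemLp.of_le (Lp.memLp f) ?_ ?_
  · exact (Complex.continuous_exp.comp (by fun_prop)).aestronglyMeasurable.mul
      (Lp.aestronglyMeasurable f)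
  · filter_upwards with x
    have : Complex.exp (2 * Real.pi * Complex.I * (b * x))
        = Complex.exp ((2 * Real.pi * (b * x) : ℝ) * Complex.I) := by
      push_cast; ring_nf
    rw [norm_mul, this, Complex.norm_exp_ofReal_mul_I, one_mul]

/-- Translation `T_a` on `L²(ℝ)`: `(T_a f)(x) = f (x - a)`. -/
def Tr (a : ℝ) (f : L2) : L2 := (memLp_translate a f).toLp _

/-- Modulation `M_b` on `L²(ℝ)`: `(M_b f)(x) = e^{2πibx} f x`. -/
def Mo (b : ℝ) (f : L2) : L2 := (memLp_modulate b f).toLp _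

/-- Time-frequency shift `π(a,b) = T_a M_b`. -/
def tf (z : ℝ × ℝ) (f : L2) : L2 := Tr z.1 (Mo z.2 f)

/-- The closed linear span `𝒢(g,Λ)` of the Gabor system `(g,Λ)`. -/
def gaborSpan (g : L2) (Λ : Set (ℝ × ℝ)) : Set L2 :=
  closure (Submodule.span ℂ ((fun z => tf z g) '' Λ) : Set L2)

/-- `𝔍(𝒢)`: the set of time-frequency shifts leaving `𝒢` invariant. -/
def stab (G : Set L2) : Set (ℝ × ℝ) := {z | ∀ f ∈ G, tf z f ∈ G}

/-- `Λ` is a lattice in `ℝ²` if `Λ = Aℤ²` for an invertible `2×2` matrix `A`. -/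
def IsLattice (Λ : Set (ℝ × ℝ)) : Prop :=
  ∃ A : Matrix (Fin 2) (Fin 2) ℝ, IsUnit A.det ∧
    Λ = {p : ℝ × ℝ | ∃ k l : ℤ,
      p = (A 0 0 * k + A 0 1 * l, A 1 0 * k + A 1 1 * l)}

lemma memLp_gaussian : MemLp (fun x : ℝ => (Real.exp (-Real.pi * x ^ 2) : ℂ)) 2
    (volume : Measure ℝ) := by
  rw [memLp_two_iff_integrable_sq_norm]
  · have h : Integrable (fun x : ℝ => Real.exp (-(2 * Real.pi) * x ^ 2)) volume :=
      integrable_exp_neg_mul_sq (by positivity)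
    refine h.congr (Eventually.of_forall fun x => ?_)
    simp only [Complex.norm_real, Real.norm_eq_abs, Real.abs_exp, sq, ← Real.exp_add]
    ring_nf
  · exact (Complex.continuous_ofReal.comp (by fun_prop)).aestronglyMeasurable

/-- The Gaussian `φ(x) = e^{-πx²}` as an element of `L²(ℝ)`. -/
def gaussL2 : L2 := memLp_gaussian.toLp _

/-- The Feichtinger algebra condition: `f ∈ S₀(ℝ)` iff `(a,b) ↦ ⟨f, π(a,b)φ⟩ ∈ L¹(ℝ²)`. -/
def InS0 (f : L2) : Prop :=
  Integrable (fun z : ℝ × ℝ => ⟪tf z gaussL2, f⟫_ℂ) (volume : Measure (ℝ × ℝ))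

/-- `(g,Λ)` is a frame for its closed linear span. -/
def IsFrameSeq (g : L2) (Λ : Set (ℝ × ℝ)) : Prop :=
  ∃ A B : ℝ, 0 < A ∧ 0 < B ∧ ∀ f ∈ gaborSpan g Λ,
    A * ‖f‖ ^ 2 ≤ ∑' lam : Λ, ‖⟪tf (lam : ℝ × ℝ) g, f⟫_ℂ‖ ^ 2 ∧
    ∑' lam : Λ, ‖⟪tf (lam : ℝ × ℝ) g, f⟫_ℂ‖ ^ 2 ≤ B * ‖f‖ ^ 2

/-- `(g,Λ)` is a frame for all of `L²(ℝ)`. -/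
def IsFrameL2 (g : L2) (Λ : Set (ℝ × ℝ)) : Prop :=
  ∃ A B : ℝ, 0 < A ∧ 0 < B ∧ ∀ f : L2,
    A * ‖f‖ ^ 2 ≤ ∑' lam : Λ, ‖⟪tf (lam : ℝ × ℝ) g, f⟫_ℂ‖ ^ 2 ∧
    ∑' lam : Λ, ‖⟪tf (lam : ℝ × ℝ) g, f⟫_ℂ‖ ^ 2 ≤ B * ‖f‖ ^ 2

/-- Euclidean ball of radius `ε` around `a ∈ ℝ²`. -/
def eball (ε : ℝ) (a : ℝ × ℝ) : Set (ℝ × ℝ) :=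
  {x : ℝ × ℝ | Real.sqrt ((x.1 - a.1) ^ 2 + (x.2 - a.2) ^ 2) < ε}

/-- `B_ε(Δ) = ⋃_{a ∈ Δ} B_ε(a)`. -/
def eballSet (ε : ℝ) (Δ : Set (ℝ × ℝ)) : Set (ℝ × ℝ) := ⋃ a ∈ Δ, eball ε a

/-- The separable lattice `αℤ × βℤ`. -/
def sepLattice (α β : ℝ) : Set (ℝ × ℝ) :=
  {p : ℝ × ℝ | ∃ k l : ℤ, p = (α * k, β * l)}


/-- The Gaussian binomial coefficient `[M, k]` at the base `p`. -/
def gaussBinom (p : ℂ) : ℕ → ℕ → ℂ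
  | 0, 0 => 1
  | 0, _ + 1 => 0
  | M + 1, 0 => gaussBinom p M 0
  | M + 1, k + 1 => p ^ (k + 1) * gaussBinom p M (k + 1) + gaussBinom p M k

lemma gaussBinom_eq_zero_of_lt (p : ℂ) {M k : ℕ} (h : M < k) : gaussBinom p M k = 0 := by
  induction M generalizing k with
  | zero => cases k with
    | zero => omega
    | succ k => simp [gaussBinom]
  | succ M ih => cases k with
    | zero => omega
    | succ k => simp [gaussBinom, ih (show M < k + 1 by omega), ih (show M < k by omega)]

lemma gaussBinom_zero_right (p : ℂ) (M : ℕ) : gaussBinom p M 0 = 1 := by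
  induction M with
  | zero => simp [gaussBinom]
  | succ M ih => simpa [gaussBinom] using ih

/-- The finite `q`-Pochhammer product `(1 - p) (1 - p²) ⋯ (1 - pⁿ)`. -/
def qPoch (p : ℂ) (n : ℕ) : ℂ := ∏ j ∈ Finset.range n, (1 - p ^ (j + 1))

lemma qPoch_succ (p : ℂ) (n : ℕ) : qPoch p (n + 1) = qPoch p n * (1 - p ^ (n + 1)) :=
  Finset.prod_range_succ _ _

lemma gaussBinom_mul_qPoch (p : ℂ) (j k : ℕ) :
    gaussBinom p (j + k) k * (qPoch p j * qPoch p k) = qPoch p (j + k) := by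
  induction h : j + k generalizing j k with
  | zero =>
    obtain ⟨rfl, rfl⟩ : j = 0 ∧ k = 0 := by omega
    simp [gaussBinom, qPoch]
  | succ M ih =>
    cases k with
    | zero =>
      obtain rfl : j = M + 1 := by omega
      rw [gaussBinom_zero_right]; simp [qPoch]
    | succ k =>
      obtain rfl : M = j + k := by omega
      have h2 := ih j k rfl
      rw [gaussBinom, qPoch_succ p k, qPoch_succ p (j + k)]
      cases j with
      | zero =>
        rw [gaussBinom_eq_zero_of_lt p (show 0 + k < k + 1 by omega)]
        have : qPoch p 0 = 1 := by simp [qPoch]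
        simp only [Nat.zero_add, this] at h2 ⊢
        linear_combination (1 - p ^ (k + 1)) * h2
      | succ j =>
        have h1 := ih j (k + 1) (by omega)
        rw [qPoch_succ p k] at h1
        rw [qPoch_succ p j] at h2 ⊢
        linear_combination (p ^ (k + 1) * (1 - p ^ (j + 1))) * h1 + (1 - p ^ (k + 1)) * h2

lemma prod_one_add_eq_sum_gaussBinom (p x : ℂ) (M : ℕ) :
    ∏ j ∈ Finset.range M, (1 + x * p ^ j) =
      ∑ k ∈ Finset.range (M + 1), gaussBinom p M k * (p ^ (k.choose 2) * x ^ k) := by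
  induction M generalizing x with
  | zero => simp [gaussBinom]
  | succ M ih =>
    rw [Finset.prod_range_succ']
    have h1 : ∏ j ∈ Finset.range M, (1 + x * p ^ (j + 1)) =
        ∏ j ∈ Finset.range M, (1 + (x * p) * p ^ j) :=
      Finset.prod_congr rfl fun j _ => by ring
    rw [h1, ih, Finset.sum_range_succ' _ (M + 1)]
    simp only [gaussBinom, add_mul, Finset.sum_add_distrib]
    have h2 : ∑ k ∈ Finset.range (M + 1),
          p ^ (k + 1) * gaussBinom p M (k + 1) * (p ^ ((k + 1).choose 2) * x ^ (k + 1)) +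
          gaussBinom p M 0 * (p ^ (Nat.choose 0 2) * x ^ 0) =
        ∑ k ∈ Finset.range (M + 1), gaussBinom p M k * (p ^ (k.choose 2) * (x * p) ^ k) := by
      rw [Finset.sum_range_succ, gaussBinom_eq_zero_of_lt p (Nat.lt_succ_self M),
        Finset.sum_range_succ' _ M]
      simp only [mul_zero, zero_mul, add_zero, pow_zero]
      congr 1
      exact Finset.sum_congr rfl fun k _ => by ring
    have h3 : ∑ k ∈ Finset.range (M + 1),
          gaussBinom p M k * (p ^ ((k + 1).choose 2) * x ^ (k + 1)) =
        x * ∑ k ∈ Finset.range (M + 1), gaussBinom p M k * (p ^ (k.choose 2) * (x * p) ^ k) := by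
      rw [Finset.mul_sum]
      refine Finset.sum_congr rfl fun k _ => ?_
      rw [Nat.choose_succ_succ' k 1, Nat.choose_one_right]
      ring
    rw [h3, ← h2]
    ring

/-- The general factor `1 + q^{2m+1} w` of the Jacobi product, with `q = e^{πiτ}`, `w = e^{2πiz}`. -/
def thetaFactor (z τ : ℂ) (m : ℕ) : ℂ :=
  1 + cexp (Real.pi * I * (2 * m + 1) * τ + 2 * Real.pi * I * z)

lemma prod_thetaFactor (z τ : ℂ) (N K : ℕ) :
    (∏ m ∈ Finset.range N, thetaFactor z τ m) * ∏ m ∈ Finset.range K, thetaFactor (-z) τ m =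
      ∑ k ∈ Finset.range (N + K + 1),
        gaussBinom (cexp (2 * Real.pi * I * τ)) (N + K) k *
          jacobiTheta₂_term ((k : ℤ) - K) z τ := by
  induction K generalizing N z with
  | zero =>
    have h := prod_one_add_eq_sum_gaussBinom (cexp (2 * Real.pi * I * τ))
      (cexp (Real.pi * I * τ + 2 * Real.pi * I * z)) N
    simp only [Finset.range_zero, Finset.prod_empty, mul_one, add_zero]
    convert h using 2
    · next m _ =>
      rw [thetaFactor, ← Complex.exp_nat_mul, ← Complex.exp_add]
      congr 2; ring
    · next k _ =>
      rw [jacobiTheta₂_term, ← Complex.exp_nat_mul, ← Complex.exp_nat_mul, ← Complex.exp_add]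
      have : ((k.choose 2 : ℕ) : ℂ) = k * (k - 1) / 2 := Nat.cast_choose_two ℂ k
      rw [this]
      congr 2; push_cast; ring
  | succ K ih =>
    have h := ih (z - τ) (N + 1)
    have e1 : thetaFactor (z - τ) τ 0 =
        cexp (2 * Real.pi * I * z - Real.pi * I * τ) * thetaFactor (-z) τ 0 := by
      simp only [thetaFactor, mul_add, ← Complex.exp_add, mul_one]
      rw [add_comm]
      congr 1
      · congr 1; push_cast; ring
      · rw [← Complex.exp_zero]; congr 1; push_cast; ring
    have e2 : ∏ m ∈ Finset.range N, thetaFactor (z - τ) τ (m + 1) =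
        ∏ m ∈ Finset.range N, thetaFactor z τ m :=
      Finset.prod_congr rfl fun m _ => by
        simp only [thetaFactor]; congr 2; push_cast; ring
    have e3 : ∏ m ∈ Finset.range K, thetaFactor (-(z - τ)) τ m =
        ∏ m ∈ Finset.range K, thetaFactor (-z) τ (m + 1) :=
      Finset.prod_congr rfl fun m _ => by
        simp only [thetaFactor]; congr 2; push_cast; ring
    rw [Finset.prod_range_succ', e1, e2, e3] at h
    rw [Finset.prod_range_succ' _ K]
    have hM : N + 1 + K = N + (K + 1) := by ring
    rw [hM] at h
    have key : ∀ k : ℕ, jacobiTheta₂_term ((k : ℤ) - K) (z - τ) τ =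
        cexp (2 * Real.pi * I * z - Real.pi * I * τ) *
          jacobiTheta₂_term ((k : ℤ) - (K + 1 : ℕ)) z τ := fun k => by
      simp only [jacobiTheta₂_term, ← Complex.exp_add]
      congr 1; push_cast; ring
    simp only [key] at h
    refine mul_left_cancel₀ (Complex.exp_ne_zero (2 * Real.pi * I * z - Real.pi * I * τ)) ?_
    rw [Finset.mul_sum]
    calc _ = _ := by ring
      _ = _ := h
      _ = _ := Finset.sum_congr rfl fun k _ => by ring

lemma exists_tendsto_prod_one_add {f : ℕ → ℂ} (hf : Summable (‖f ·‖)) (h : ∀ i, 1 + f i ≠ 0) :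
    ∃ L : ℂ, L ≠ 0 ∧
      Tendsto (fun n => ∏ i ∈ Finset.range n, (1 + f i)) atTop (nhds L) :=
  ⟨_, tprod_one_add_ne_zero_of_summable h hf,
    (multipliable_one_add_of_summable hf).hasProd.tendsto_prod_nat⟩

lemma one_sub_pow_succ_ne_zero {p : ℂ} (hp : ‖p‖ < 1) (n : ℕ) : 1 - p ^ (n + 1) ≠ 0 := by
  intro h
  have h1 : ‖p ^ (n + 1)‖ = 1 := by rw [← sub_eq_zero.mp h, norm_one]
  rw [norm_pow] at h1
  exact (pow_lt_one₀ (norm_nonneg _) hp n.succ_ne_zero).ne h1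

lemma exists_tendsto_qPoch {p : ℂ} (hp : ‖p‖ < 1) :
    ∃ L : ℂ, L ≠ 0 ∧ Tendsto (qPoch p) atTop (nhds L) := by
  have hs : Summable fun n : ℕ => ‖-p ^ (n + 1)‖ := by
    simpa using (summable_nat_add_iff 1).mpr (summable_geometric_of_lt_one (norm_nonneg p) hp)
  obtain ⟨L, hL, h⟩ := exists_tendsto_prod_one_add hs fun n => by
    rw [← sub_eq_add_neg]; exact one_sub_pow_succ_ne_zero hp n
  refine ⟨L, hL, h.congr fun n => ?_⟩
  simp [qPoch, sub_eq_add_neg]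

lemma qPoch_ne_zero {p : ℂ} (hp : ‖p‖ < 1) (n : ℕ) : qPoch p n ≠ 0 :=
  Finset.prod_ne_zero_iff.mpr fun j _ => one_sub_pow_succ_ne_zero hp j

lemma gaussBinom_eq_div {p : ℂ} (hp : ‖p‖ < 1) (j k : ℕ) :
    gaussBinom p (j + k) k = qPoch p (j + k) * ((qPoch p j)⁻¹ * (qPoch p k)⁻¹) := by
  rw [← gaussBinom_mul_qPoch p j k]
  field_simp [qPoch_ne_zero hp j, qPoch_ne_zero hp k]

lemma exists_norm_gaussBinom_le {p : ℂ} (hp : ‖p‖ < 1) :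
    ∃ B : ℝ, ∀ M k : ℕ, ‖gaussBinom p M k‖ ≤ B := by
  obtain ⟨L, hL, h⟩ := exists_tendsto_qPoch hp
  obtain ⟨B₁, hB₁⟩ := h.norm.bddAbove_range
  obtain ⟨B₂, hB₂⟩ := (h.inv₀ hL).norm.bddAbove_range
  have h₁ : ∀ n, ‖qPoch p n‖ ≤ B₁ := fun n => hB₁ ⟨n, rfl⟩
  have h₂ : ∀ n, ‖(qPoch p n)⁻¹‖ ≤ B₂ := fun n => hB₂ ⟨n, rfl⟩
  have p₁ : 0 ≤ B₁ := (norm_nonneg _).trans (h₁ 0)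
  have p₂ : 0 ≤ B₂ := (norm_nonneg _).trans (h₂ 0)
  refine ⟨B₁ * (B₂ * B₂), fun M k => ?_⟩
  rcases lt_or_ge M k with hk | hk
  · rw [gaussBinom_eq_zero_of_lt p hk, norm_zero]; positivity
  · obtain ⟨j, rfl⟩ := Nat.exists_eq_add_of_le' hk
    rw [gaussBinom_eq_div hp, norm_mul, norm_mul]
    exact mul_le_mul (h₁ _) (mul_le_mul (h₂ _) (h₂ _) (norm_nonneg _) p₂)
      (mul_nonneg (norm_nonneg _) (norm_nonneg _)) p₁

lemma tendsto_gaussBinom_central {p L : ℂ} (hp : ‖p‖ < 1) (hL : L ≠ 0)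
    (h : Tendsto (qPoch p) atTop (nhds L)) (n : ℤ) :
    Tendsto (fun N : ℕ => gaussBinom p (N + N) (n + N).toNat) atTop (nhds L⁻¹) := by
  have t₀ : Tendsto (fun N : ℕ => N + N) atTop atTop :=
    tendsto_atTop_mono (fun N => Nat.le_add_right N N) tendsto_id
  have t₁ (m : ℤ) : Tendsto (fun N : ℕ => (m + N).toNat) atTop atTop := by
    refine tendsto_atTop.mpr fun b => ?_
    filter_upwards [eventually_ge_atTop (b + m.natAbs)] with N hN
    omega
  have key := (h.comp t₀).mul (((h.comp (t₁ (-n))).inv₀ hL).mul ((h.comp (t₁ n)).inv₀ hL))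
  rw [show L * (L⁻¹ * L⁻¹) = L⁻¹ by field_simp] at key
  refine key.congr' ?_
  filter_upwards [eventually_ge_atTop n.natAbs] with N hN
  have : N + N = (-n + N).toNat + (n + N).toNat := by omega
  rw [this, gaussBinom_eq_div hp, ← this]
  rfl

lemma prod_thetaFactor_eq_tsum (z τ : ℂ) (N : ℕ) :
    (∏ m ∈ Finset.range N, thetaFactor z τ m) * ∏ m ∈ Finset.range N, thetaFactor (-z) τ m =
      ∑' n : ℤ, (if 0 ≤ n + N then
        gaussBinom (cexp (2 * Real.pi * I * τ)) (N + N) (n + N).toNat * jacobiTheta₂_term n z τ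
        else 0) := by
  have hinj : Function.Injective fun k : ℕ => (k : ℤ) - N := fun a b hab => by
    simp only at hab; omega
  rw [prod_thetaFactor, ← hinj.tsum_eq]
  · rw [tsum_eq_sum (s := Finset.range (N + N + 1))]
    · exact Finset.sum_congr rfl fun k _ => by simp
    · intro k hk
      rw [Finset.mem_range] at hk
      simp [gaussBinom_eq_zero_of_lt _ (show N + N < k by omega)]
  · intro n hn
    rw [Function.mem_support] at hn
    have h0 : 0 ≤ n + N := by
      by_contra h
      exact hn (if_neg h)
    exact ⟨(n + N).toNat, by simp only; omega⟩

lemma norm_cexp_two_pi_I_mul_lt_one {τ : ℂ} (hτ : 0 < τ.im) :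
    ‖cexp (2 * Real.pi * I * τ)‖ < 1 := by
  rw [Complex.norm_exp, Real.exp_lt_one_iff]
  have : (2 * Real.pi * I * τ).re = -(2 * Real.pi * τ.im) := by simp
  rw [this]
  have := mul_pos Real.two_pi_pos hτ
  linarith

/-- The Jacobi triple product, up to a nonzero constant. -/
lemma exists_tendsto_prod_thetaFactor {τ : ℂ} (hτ : 0 < τ.im) :
    ∃ C : ℂ, C ≠ 0 ∧ ∀ z : ℂ, Tendsto (fun N : ℕ =>
      (∏ m ∈ Finset.range N, thetaFactor z τ m) * ∏ m ∈ Finset.range N, thetaFactor (-z) τ m)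
      atTop (nhds (C * jacobiTheta₂ z τ)) := by
  have hp := norm_cexp_two_pi_I_mul_lt_one hτ
  obtain ⟨L, hL, h⟩ := exists_tendsto_qPoch hp
  obtain ⟨B, hB⟩ := exists_norm_gaussBinom_le hp
  have hB0 : 0 ≤ B := (norm_nonneg _).trans (hB 0 0)
  refine ⟨L⁻¹, inv_ne_zero hL, fun z => ?_⟩
  simp only [prod_thetaFactor_eq_tsum]
  rw [jacobiTheta₂, ← tsum_mul_left]
  have hs := ((summable_jacobiTheta₂_term_iff z τ).mpr hτ).norm.mul_left B
  refine tendsto_tsum_of_dominated_convergence hs (fun n => ?_) (Eventually.of_forall fun N n => ?_)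
  · refine ((tendsto_gaussBinom_central hp hL h n).mul_const _).congr' ?_
    filter_upwards [eventually_ge_atTop n.natAbs] with N hN
    rw [if_pos (by omega)]
  · split_ifs
    · rw [norm_mul]
      exact mul_le_mul_of_nonneg_right (hB _ _) (norm_nonneg _)
    · rw [norm_zero]; positivity

lemma thetaFactor_eq_zero_iff (z τ : ℂ) (m : ℕ) :
    thetaFactor z τ m = 0 ↔ ∃ k : ℤ, z = 1 / 2 + k - (m + 1 / 2) * τ := by
  rw [thetaFactor, add_comm, add_eq_zero_iff_eq_neg, ← Complex.exp_pi_mul_I,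
    Complex.exp_eq_exp_iff_exists_int]
  have hpi : (Real.pi * I : ℂ) ≠ 0 := by simp [Real.pi_ne_zero]
  refine exists_congr fun k => ⟨fun h => ?_, fun h => ?_⟩
  · refine mul_left_cancel₀ (mul_ne_zero two_ne_zero hpi) ?_
    linear_combination h
  · rw [h]; ring

lemma exists_tendsto_prod_thetaFactor_ne_zero {z τ : ℂ} (hτ : 0 < τ.im)
    (h : ∀ m, thetaFactor z τ m ≠ 0) :
    ∃ L : ℂ, L ≠ 0 ∧
      Tendsto (fun N => ∏ m ∈ Finset.range N, thetaFactor z τ m) atTop (nhds L) := by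
  refine exists_tendsto_prod_one_add ?_ h
  have hp := norm_cexp_two_pi_I_mul_lt_one hτ
  refine ((summable_geometric_of_lt_one (norm_nonneg _) hp).mul_left
    ‖cexp (Real.pi * I * τ + 2 * Real.pi * I * z)‖).congr fun m => ?_
  rw [← norm_pow, ← norm_mul, ← Complex.exp_nat_mul, ← Complex.exp_add]
  congr 2
  ring

/-- The zeros of the Jacobi theta function are the points `(1 + τ) / 2 + k + l τ`. -/
theorem jacobiTheta₂_eq_zero_iff {z τ : ℂ} (hτ : 0 < τ.im) :
    jacobiTheta₂ z τ = 0 ↔ ∃ k l : ℤ, z = 1 / 2 + τ / 2 + k + l * τ := by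
  obtain ⟨C, hC, hlim⟩ := exists_tendsto_prod_thetaFactor hτ
  have hfac : (∃ k l : ℤ, z = 1 / 2 + τ / 2 + k + l * τ) ↔
      ∃ m, thetaFactor z τ m = 0 ∨ thetaFactor (-z) τ m = 0 := by
    simp only [thetaFactor_eq_zero_iff]
    constructor
    · rintro ⟨k, l, rfl⟩
      rcases lt_or_ge l 0 with hl | hl
      · obtain ⟨m, rfl⟩ : ∃ m : ℕ, l = -1 - m := ⟨(-1 - l).toNat, by omega⟩
        exact ⟨m, Or.inl ⟨k, by push_cast; ring⟩⟩
      · obtain ⟨m, rfl⟩ := Int.eq_ofNat_of_zero_le hl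
        exact ⟨m, Or.inr ⟨-1 - k, by push_cast; ring⟩⟩
    · rintro ⟨m, ⟨k, h⟩ | ⟨k, h⟩⟩
      · exact ⟨k, -1 - m, by rw [h]; push_cast; ring⟩
      · exact ⟨-1 - k, m, by rw [neg_eq_iff_eq_neg.mp h]; push_cast; ring⟩
  rw [hfac]
  constructor
  · intro h0
    by_contra! hne
    obtain ⟨L₁, h₁, t₁⟩ := exists_tendsto_prod_thetaFactor_ne_zero hτ fun m => (hne m).1
    obtain ⟨L₂, h₂, t₂⟩ := exists_tendsto_prod_thetaFactor_ne_zero hτ fun m => (hne m).2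
    have := tendsto_nhds_unique (hlim z) (t₁.mul t₂)
    rw [h0, mul_zero] at this
    exact mul_ne_zero h₁ h₂ this.symm
  · rintro ⟨m, hm⟩
    have hz : C * jacobiTheta₂ z τ = 0 := by
      refine tendsto_nhds_unique (hlim z) (tendsto_const_nhds.congr' ?_)
      filter_upwards [eventually_gt_atTop m] with N hN
      have hmem := Finset.mem_range.mpr hN
      rcases hm with hm | hm
      · rw [Finset.prod_eq_zero hmem hm, zero_mul]
      · rw [Finset.prod_eq_zero (f := thetaFactor (-z) τ) hmem hm, mul_zero]
    exact (mul_eq_zero.mp hz).resolve_left hC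

lemma jacobiTheta₂_term_add (n : ℤ) (y z τ : ℂ) :
    jacobiTheta₂_term n (y + z) τ = cexp (2 * Real.pi * I * n * y) * jacobiTheta₂_term n z τ := by
  simp only [jacobiTheta₂_term, ← Complex.exp_add]
  congr 1; ring

lemma norm_jacobiTheta₂_term_ofReal_add (n : ℤ) (y : ℝ) (z τ : ℂ) :
    ‖jacobiTheta₂_term n (y + z) τ‖ = ‖jacobiTheta₂_term n z τ‖ := by
  rw [jacobiTheta₂_term_add, norm_mul, Complex.norm_exp]
  simp

lemma norm_jacobiTheta₂_ofReal_add_le (y : ℝ) (z : ℂ) {τ : ℂ} (hτ : 0 < τ.im) :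
    ‖jacobiTheta₂ (y + z) τ‖ ≤ ∑' n : ℤ, ‖jacobiTheta₂_term n z τ‖ := by
  have h := norm_tsum_le_tsum_norm ((summable_jacobiTheta₂_term_iff (y + z) τ).mpr hτ).norm
  simp only [norm_jacobiTheta₂_term_ofReal_add] at h
  exact h

lemma integral_gaussian_mul_jacobiTheta₂ {D σ : ℂ} (hD : 0 < D.re) (hσ : 0 < σ.im) (t : ℝ)
    (z w : ℂ) :
    ∫ x : ℝ, cexp (-D * x ^ 2 + 2 * w * x) * jacobiTheta₂ ((t * x : ℝ) + z) σ =
      (Real.pi / D) ^ (1 / 2 : ℂ) * cexp (w ^ 2 / D) *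
        jacobiTheta₂ (z + t * w / D) (σ + I * Real.pi * t ^ 2 / D) := by
  have hD0 : D ≠ 0 := by rintro rfl; simp at hD
  have hexp (n : ℤ) (x : ℝ) :
      cexp (-D * x ^ 2 + 2 * w * x) * jacobiTheta₂_term n ((t * x : ℝ) + z) σ =
        cexp (-D * x ^ 2 + (2 * w + 2 * Real.pi * I * n * t) * x +
          (2 * Real.pi * I * n * z + Real.pi * I * n ^ 2 * σ)) := by
    simp only [jacobiTheta₂_term, ← Complex.exp_add]
    congr 1; push_cast; ring
  have hint (n : ℤ) : Integrable fun x : ℝ =>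
      cexp (-D * x ^ 2 + 2 * w * x) * jacobiTheta₂_term n ((t * x : ℝ) + z) σ := by
    simp only [hexp]
    exact integrable_cexp_quadratic hD _ _
  have hsum : Summable fun n : ℤ => ∫ x : ℝ,
      ‖cexp (-D * x ^ 2 + 2 * w * x) * jacobiTheta₂_term n ((t * x : ℝ) + z) σ‖ := by
    simp only [norm_mul, norm_jacobiTheta₂_term_ofReal_add, integral_mul_const]
    exact ((summable_jacobiTheta₂_term_iff z σ).mpr hσ).norm.mul_left _
  simp only [jacobiTheta₂, ← tsum_mul_left]
  rw [← integral_tsum_of_summable_integral_norm hint hsum]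
  refine tsum_congr fun n => ?_
  simp only [hexp]
  rw [integral_cexp_quadratic (by simpa using hD), neg_neg, jacobiTheta₂_term,
    mul_assoc (_ ^ _), ← Complex.exp_add]
  congr 2
  field_simp
  ring_nf

lemma memLp_gaussian_mul_jacobiTheta₂ {α σ : ℂ} (hα : 0 < α.re) (hσ : 0 < σ.im) (t : ℝ) (z : ℂ) :
    MemLp (fun x : ℝ => cexp (-α * x ^ 2) * jacobiTheta₂ ((t * x : ℝ) + z) σ) 2
      (volume : Measure ℝ) := by
  have hmeas : Continuous fun x : ℝ => jacobiTheta₂ ((t * x : ℝ) + z) σ :=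
    continuous_iff_continuousAt.mpr fun x =>
      (differentiableAt_jacobiTheta₂_fst ((t * x : ℝ) + z) hσ).continuousAt.comp_of_eq
        (by fun_prop) rfl
  have hcont : Continuous fun x : ℝ => cexp (-α * x ^ 2) := by fun_prop
  have hgauss : MemLp (fun x : ℝ => cexp (-α * x ^ 2)) 2 (volume : Measure ℝ) := by
    rw [memLp_two_iff_integrable_sq_norm hcont.aestronglyMeasurable]
    refine (integrable_exp_neg_mul_sq (b := 2 * α.re) (by positivity)).congr
      (Eventually.of_forall fun x => ?_)
    have hre : (-α * (x : ℂ) ^ 2).re = -α.re * x ^ 2 := by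
      rw [← ofReal_pow, Complex.re_mul_ofReal, neg_re]
    simp only [Complex.norm_exp, hre, sq (Real.exp _), ← Real.exp_add]
    ring_nf
  refine hgauss.of_le_mul (c := ∑' n : ℤ, ‖jacobiTheta₂_term n z σ‖)
    (hcont.mul hmeas).aestronglyMeasurable (Eventually.of_forall fun x => ?_)
  rw [norm_mul, mul_comm]
  exact mul_le_mul_of_nonneg_right (norm_jacobiTheta₂_ofReal_add_le _ _ hσ) (norm_nonneg _)

lemma coeFn_tf (z : ℝ × ℝ) (f : L2) :
    (tf z f : ℝ → ℂ) =ᵐ[volume]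
      fun x => cexp (2 * Real.pi * I * (z.2 * (x - z.1))) * f (x - z.1) := by
  have h₁ : (tf z f : ℝ → ℂ) =ᵐ[volume] fun x => (Mo z.2 f) (x - z.1) :=
    (memLp_translate z.1 (Mo z.2 f)).coeFn_toLp
  have h₂ : (Mo z.2 f : ℝ → ℂ) =ᵐ[volume]
      fun x => cexp (2 * Real.pi * I * (z.2 * x)) * f x :=
    (memLp_modulate z.2 f).coeFn_toLp
  have h₃ := (measurePreserving_sub_right volume z.1).quasiMeasurePreserving.ae_eq_comp h₂
  filter_upwards [h₁, h₃] with x hx₁ hx₃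
  rw [hx₁]
  simpa using hx₃

lemma coeFn_tf_of_ae_eq (z : ℝ × ℝ) {f : L2} {φ : ℝ → ℂ} (h : (f : ℝ → ℂ) =ᵐ[volume] φ) :
    (tf z f : ℝ → ℂ) =ᵐ[volume]
      fun x => cexp (2 * Real.pi * I * (z.2 * (x - z.1))) * φ (x - z.1) := by
  have h₃ := (measurePreserving_sub_right volume z.1).quasiMeasurePreserving.ae_eq_comp h
  filter_upwards [coeFn_tf z f, h₃] with x hx₁ hx₃
  simp only [Function.comp_apply] at hx₃
  rw [hx₁, hx₃]

lemma inner_tf_gaussian {c : ℝ} {g : L2}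
    (hg : (g : ℝ → ℂ) =ᵐ[volume] fun x : ℝ => (Real.exp (-c * x ^ 2) : ℂ))
    {α : ℂ} {h : ℝ → ℂ} {f : L2}
    (hf : (f : ℝ → ℂ) =ᵐ[volume] fun x : ℝ => cexp (-α * x ^ 2) * h x) (z : ℝ × ℝ) :
    ⟪tf z g, f⟫_ℂ = cexp (-c * z.1 ^ 2 + 2 * Real.pi * I * z.1 * z.2) *
      ∫ x : ℝ, cexp (-(c + α) * x ^ 2 + 2 * (c * z.1 - Real.pi * I * z.2) * x) * h x := by
  rw [L2.inner_def, ← integral_const_mul]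
  refine integral_congr_ae ?_
  filter_upwards [coeFn_tf_of_ae_eq z hg, hf] with x hx hfx
  rw [hx, hfx, RCLike.inner_apply, map_mul, Complex.conj_ofReal, ← Complex.exp_conj,
    Complex.ofReal_exp]
  simp only [map_mul, map_sub, Complex.conj_ofReal, Complex.conj_I, map_ofNat]
  rw [mul_right_comm, ← mul_assoc (cexp (-c * z.1 ^ 2 + 2 * Real.pi * I * z.1 * z.2))]
  congr 1
  simp only [← Complex.exp_add]
  congr 1
  push_cast
  ring

/-- For a lattice of density less than one, the Gaussian time-frequency shift by a point outside
the lattice is separated from the lattice shifts by an element of `L²(ℝ)`. -/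
lemma exists_separating {c : ℝ} (hc : 0 < c) {g : L2}
    (hg : (g : ℝ → ℂ) =ᵐ[volume] fun x : ℝ => (Real.exp (-c * x ^ 2) : ℂ))
    {p₁ p₂ r₁ r₂ : ℝ} (hp : p₁ ≠ 0) (hdet : 1 < p₂ * r₁ - p₁ * r₂) :
    ∃ f : L2, ∀ z : ℝ × ℝ, ⟪tf z g, f⟫_ℂ = 0 ↔
      ∃ k l : ℤ, z = (p₁ * k + r₁ * l, p₂ * k + r₂ * l) := by
  obtain ⟨s, hs₁, hs₂⟩ := exists_between hdet
  set t : ℝ := s / p₁ with ht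
  have htp : t * p₁ = s := by rw [ht]; field_simp
  have ht0 : t ≠ 0 := by rintro h; rw [h] at htp; linarith
  set ω₁ : ℂ := ⟨c * p₁, -(Real.pi * p₂)⟩ with hω₁
  set ω₂ : ℂ := ⟨c * r₁, -(Real.pi * r₂)⟩ with hω₂
  have hω₁0 : ω₁ ≠ 0 := fun h => by
    have := congrArg Complex.re h
    simp [hω₁, hc.ne', hp] at this
  have hN : 0 < Complex.normSq ω₁ := Complex.normSq_pos.mpr hω₁0
  set τ : ℂ := ω₂ / ω₁ with hτdef
  set D : ℂ := t * ω₁ with hDdef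
  set α : ℂ := D - c with hαdef
  set σ : ℂ := τ - I * Real.pi * t / ω₁ with hσdef
  have hDre : D.re = c * s := by
    rw [hDdef, Complex.re_ofReal_mul, ← htp]; ring
  have hD : 0 < D.re := by rw [hDre]; exact mul_pos hc (by linarith)
  have hα : 0 < α.re := by
    rw [hαdef, Complex.sub_re, Complex.ofReal_re, hDre]; nlinarith
  have hτim : τ.im = c * Real.pi * (p₂ * r₁ - p₁ * r₂) / Complex.normSq ω₁ := by
    rw [hτdef, Complex.div_im]
    simp only [hω₁, hω₂]
    ring
  have hτ : 0 < τ.im := by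
    rw [hτim]
    have := Real.pi_pos
    have : 0 < p₂ * r₁ - p₁ * r₂ := by linarith
    positivity
  have hσ : 0 < σ.im := by
    have h1 : (I * Real.pi * t / ω₁).im = c * Real.pi * s / Complex.normSq ω₁ := by
      rw [Complex.div_im, ← htp]
      simp [hω₁]
      ring
    rw [hσdef, Complex.sub_im, hτim, h1, ← sub_div]
    refine div_pos ?_ hN
    have := mul_pos hc Real.pi_pos
    nlinarith
  have hD0 : D ≠ 0 := by rintro h; rw [h] at hD; simp at hD
  refine ⟨(memLp_gaussian_mul_jacobiTheta₂ hα hσ t (1 / 2 + τ / 2)).toLp _, fun z => ?_⟩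
  rw [inner_tf_gaussian hg (MemLp.coeFn_toLp _) z]
  have hcα : (c : ℂ) + α = D := by rw [hαdef]; ring
  rw [hcα, integral_gaussian_mul_jacobiTheta₂ hD hσ]
  have hσ' : σ + I * Real.pi * t ^ 2 / D = τ := by
    rw [hσdef, hDdef]
    have : (t : ℂ) ≠ 0 := Complex.ofReal_ne_zero.mpr ht0
    field_simp
    ring
  have hpre : (Real.pi / D : ℂ) ^ (1 / 2 : ℂ) ≠ 0 := by
    rw [Ne, Complex.cpow_eq_zero_iff]
    simp [hD0, Real.pi_ne_zero]
  rw [hσ', mul_eq_zero, or_iff_right (Complex.exp_ne_zero _), mul_eq_zero,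
    or_iff_right (mul_ne_zero hpre (Complex.exp_ne_zero _)), jacobiTheta₂_eq_zero_iff hτ]
  refine exists_congr fun k => exists_congr fun l => ?_
  have hw : (c * z.1 - Real.pi * I * z.2 : ℂ) = ⟨c * z.1, -(Real.pi * z.2)⟩ := by
    apply Complex.ext <;> simp
  rw [hw, hDdef, mul_div_mul_left _ _ (Complex.ofReal_ne_zero.mpr ht0), add_assoc _ (k : ℂ),
    add_right_inj, div_eq_iff hω₁0, hτdef, add_mul, mul_assoc, div_mul_cancel₀ _ hω₁0,
    Complex.ext_iff, Prod.ext_iff]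
  simp only [Complex.add_re, Complex.add_im, Complex.mul_re, Complex.mul_im, Complex.intCast_re,
    Complex.intCast_im, hω₁, hω₂]
  refine and_congr ⟨fun h => ?_, fun h => ?_⟩ ⟨fun h => ?_, fun h => ?_⟩
  · exact mul_left_cancel₀ hc.ne' (by linear_combination h)
  · rw [h]; ring
  · exact mul_left_cancel₀ Real.pi_ne_zero (by linear_combination -h)
  · rw [h]; ring

lemma tf_add (z : ℝ × ℝ) (f₁ f₂ : L2) : tf z (f₁ + f₂) = tf z f₁ + tf z f₂ := by
  refine Lp.ext ?_
  filter_upwards [coeFn_tf_of_ae_eq z (Lp.coeFn_add f₁ f₂), coeFn_tf z f₁, coeFn_tf z f₂,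
    Lp.coeFn_add (tf z f₁) (tf z f₂)] with x h h₁ h₂ h₃
  simp only [h, h₃, Pi.add_apply, h₁, h₂, mul_add]

lemma tf_smul (z : ℝ × ℝ) (a : ℂ) (f : L2) : tf z (a • f) = a • tf z f := by
  refine Lp.ext ?_
  filter_upwards [coeFn_tf_of_ae_eq z (Lp.coeFn_smul a f), coeFn_tf z f,
    Lp.coeFn_smul a (tf z f)] with x h h₁ h₂
  simp only [h, h₂, Pi.smul_apply, h₁, smul_eq_mul, mul_left_comm]

lemma norm_tf (z : ℝ × ℝ) (f : L2) : ‖tf z f‖ = ‖f‖ := by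
  have h : eLpNorm (tf z f) 2 volume = eLpNorm (fun x : ℝ => f (x - z.1)) 2 volume := by
    refine eLpNorm_congr_norm_ae ?_
    filter_upwards [coeFn_tf z f] with x hx
    have : (2 * Real.pi * I * (z.2 * (x - z.1)) : ℂ) =
        ((2 * Real.pi * (z.2 * (x - z.1)) : ℝ) : ℂ) * I := by push_cast; ring
    rw [hx, norm_mul, this, Complex.norm_exp_ofReal_mul_I, one_mul]
  rw [Lp.norm_def, Lp.norm_def, h]
  congr 1
  exact eLpNorm_comp_measurePreserving (Lp.aestronglyMeasurable f)
    (measurePreserving_sub_right volume z.1)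

/-- The time-frequency shift `π(z)` as a linear isometry of `L²(ℝ)`. -/
def tfIsometry (z : ℝ × ℝ) : L2 →ₗᵢ[ℂ] L2 where
  toFun := tf z
  map_add' := tf_add z
  map_smul' := tf_smul z
  norm_map' := norm_tf z

lemma tf_zero (f : L2) : tf 0 f = f := by
  refine Lp.ext ?_
  filter_upwards [coeFn_tf 0 f] with x h
  rw [h]; simp

lemma tf_tf (z w : ℝ × ℝ) (f : L2) :
    tf z (tf w f) = cexp (2 * Real.pi * I * (z.2 * w.1)) • tf (z + w) f := by
  refine Lp.ext ?_
  filter_upwards [coeFn_tf_of_ae_eq z (coeFn_tf w f), coeFn_tf (z + w) f,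
    Lp.coeFn_smul (cexp (2 * Real.pi * I * (z.2 * w.1))) (tf (z + w) f)] with x h h₁ h₂
  rw [h, h₂, Pi.smul_apply, h₁, smul_eq_mul, ← mul_assoc (cexp _), ← mul_assoc (cexp _),
    ← Complex.exp_add, ← Complex.exp_add, Prod.fst_add, Prod.snd_add, sub_sub]
  congr 2
  push_cast
  ring

lemma tf_mem_gaborSpan {g : L2} {Λ : Set (ℝ × ℝ)} {z : ℝ × ℝ} (hz : z ∈ Λ) :
    tf z g ∈ gaborSpan g Λ :=
  subset_closure (Submodule.subset_span ⟨z, hz, rfl⟩)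

lemma mem_stab_gaborSpan {g : L2} {Λ : Set (ℝ × ℝ)} {z : ℝ × ℝ} (hz : ∀ w ∈ Λ, z + w ∈ Λ) :
    z ∈ stab (gaborSpan g Λ) := by
  have hspan : Submodule.span ℂ ((fun w => tf w g) '' Λ) ≤
      (Submodule.span ℂ ((fun w => tf w g) '' Λ)).comap (tfIsometry z).toLinearMap := by
    rw [Submodule.span_le]
    rintro _ ⟨w, hw, rfl⟩
    change tf z (tf w g) ∈ Submodule.span ℂ _
    rw [tf_tf]
    exact Submodule.smul_mem _ _ (Submodule.subset_span ⟨z + w, hz w hw, rfl⟩)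
  intro f hf
  exact map_mem_closure (tfIsometry z).continuous hf fun h hh => hspan hh

lemma inner_eq_zero_of_mem_gaborSpan {g f : L2} {Λ : Set (ℝ × ℝ)}
    (h : ∀ z ∈ Λ, ⟪tf z g, f⟫_ℂ = 0) {u : L2} (hu : u ∈ gaborSpan g Λ) : ⟪u, f⟫_ℂ = 0 := by
  have hspan : Submodule.span ℂ ((fun w => tf w g) '' Λ) ≤ (ℂ ∙ f)ᗮ := by
    rw [Submodule.span_le]
    rintro _ ⟨w, hw, rfl⟩
    exact Submodule.mem_orthogonal_singleton_iff_inner_left.mpr (h w hw)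
  have hmem := closure_minimal hspan (Submodule.isClosed_orthogonal (ℂ ∙ f)) hu
  exact Submodule.mem_orthogonal_singleton_iff_inner_left.mp hmem

/-- Generators of a planar lattice can be chosen with the first one not vertical and with
negative orientation. -/
lemma exists_generators (A : Matrix (Fin 2) (Fin 2) ℝ) (hA : A.det ≠ 0) :
    ∃ p₁ p₂ r₁ r₂ : ℝ, p₁ ≠ 0 ∧ p₂ * r₁ - p₁ * r₂ = |A.det| ∧
      ∀ z : ℝ × ℝ,
        (∃ k l : ℤ, z = (A 0 0 * k + A 0 1 * l, A 1 0 * k + A 1 1 * l)) ↔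
          ∃ k l : ℤ, z = (p₁ * k + r₁ * l, p₂ * k + r₂ * l) := by
  have hflip : ∀ a b c d : ℝ, a ≠ 0 → |a * d - c * b| = |A.det| →
      ∃ p₁ p₂ r₁ r₂ : ℝ, p₁ ≠ 0 ∧ p₂ * r₁ - p₁ * r₂ = |A.det| ∧ ∀ z : ℝ × ℝ,
        (∃ k l : ℤ, z = (a * k + c * l, b * k + d * l)) ↔
          ∃ k l : ℤ, z = (p₁ * k + r₁ * l, p₂ * k + r₂ * l) := by
    intro a b c d ha hdet
    rcases le_total (a * d - c * b) 0 with h | h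
    · refine ⟨a, b, c, d, ha, ?_, fun z => Iff.rfl⟩
      rw [← hdet, abs_of_nonpos h]; ring
    · refine ⟨a, b, -c, -d, ha, ?_, fun z => exists_congr fun k => ⟨?_, ?_⟩⟩
      · rw [← hdet, abs_of_nonneg h]; ring
      · rintro ⟨l, rfl⟩
        exact ⟨-l, by push_cast; ring_nf⟩
      · rintro ⟨l, rfl⟩
        exact ⟨-l, by push_cast; ring_nf⟩
  rw [Matrix.det_fin_two] at hA hflip ⊢
  by_cases h : A 0 0 = 0
  · have h01 : A 0 1 ≠ 0 := by
      intro h'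
      rw [h, h'] at hA
      simp at hA
    obtain ⟨p₁, p₂, r₁, r₂, hp, hd, hz⟩ := hflip (A 0 1) (A 1 1) (A 0 0) (A 1 0) h01
      (by rw [abs_sub_comm])
    refine ⟨p₁, p₂, r₁, r₂, hp, hd, fun z => ?_⟩
    rw [← hz, exists_comm]
    simp only [add_comm]
  · exact hflip _ _ _ _ h rfl

/-- for a Gaussian `g(x) = e^{-cx²}` and a lattice `Λ = Aℤ²`
of density `|det A|⁻¹ < 1`, the only invariant time-frequency shifts of
`𝒢(g,Λ)` are those in `Λ`. -/
theorem statement_17 (c : ℝ) (hc : 0 < c) (g : L2)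
    (hgdef : (g : ℝ → ℂ) =ᵐ[volume] fun x : ℝ => (Real.exp (-c * x ^ 2) : ℂ))
    (Λ : Set (ℝ × ℝ)) (A : Matrix (Fin 2) (Fin 2) ℝ) (hA : IsUnit A.det)
    (hΛ : Λ = {p : ℝ × ℝ | ∃ k l : ℤ,
      p = (A 0 0 * k + A 0 1 * l, A 1 0 * k + A 1 1 * l)})
    (hdens : |A.det|⁻¹ < 1) :
    stab (gaborSpan g Λ) = Λ := by
  have hdet0 : A.det ≠ 0 := hA.ne_zero
  obtain ⟨p₁, p₂, r₁, r₂, hp, hpr, hgen⟩ := exists_generators A hdet0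
  have hdet : 1 < |A.det| := by
    rwa [inv_lt_one₀ (abs_pos.mpr hdet0)] at hdens
  obtain ⟨f, hf⟩ := exists_separating hc hgdef hp (hpr ▸ hdet)
  have hmem : ∀ z, z ∈ Λ ↔ ⟪tf z g, f⟫_ℂ = 0 := fun z => by
    rw [hf, ← hgen, hΛ, Set.mem_ofPred_eq]
  refine Set.Subset.antisymm (fun z hz => ?_) fun z hz => mem_stab_gaborSpan fun w hw => ?_
  · have h0 : (0 : ℝ × ℝ) ∈ Λ := by
      rw [hΛ]
      exact ⟨0, 0, by ext <;> simp⟩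
    have hg : g ∈ gaborSpan g Λ := by
      simpa only [tf_zero] using tf_mem_gaborSpan (g := g) h0
    rw [hmem]
    exact inner_eq_zero_of_mem_gaborSpan (fun w hw => (hmem w).mp hw) (hz g hg)
  · rw [hΛ] at hz hw ⊢
    obtain ⟨k, l, rfl⟩ := hz
    obtain ⟨m, n, rfl⟩ := hw
    exact ⟨k + m, l + n, by ext <;> (push_cast; simp; ring)⟩

end
end

section
/- Let α, β > 0 and let z ∈ ℝ² with z ≠ 0. Let L_z = {tz : t ∈ ℝ} and Λ = αℤ×βℤ, and assume that Λ ∩ L_z = {0}. For x ∈ ℝ², let x mod Λ denote the unique element μ ∈ [0,α) × [0,β) with x ∈ μ + Λ. Then the set {tz mod Λ : t ∈ ℝ} is dense in [0,α) × [0,β). -/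
open MeasureTheory Complex Filter
open scoped ENNReal InnerProductSpace RealInnerProductSpace ComplexConjugate

noncomputable section

/-- A point of the half-open interval `[0, a)` is determined by its class modulo `aℤ`. -/
lemma eq_of_mem_Ico_of_sub_eq_mul_int {a x y : ℝ} (hx : x ∈ Set.Ico 0 a)
    (hy : y ∈ Set.Ico 0 a) {k : ℤ} (h : x - y = a * k) : x = y := by
  obtain ⟨hx0, hxa⟩ := hx
  obtain ⟨hy0, hya⟩ := hy
  have ha : 0 < a := hx0.trans_lt hxa
  have h1 : (k : ℝ) < 1 := by
    by_contra! hk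
    nlinarith
  have h2 : (-1 : ℝ) < k := by
    by_contra! hk
    nlinarith
  have hk : k = 0 := by
    have h1' : k < 1 := by exact_mod_cast h1
    have h2' : -1 < k := by exact_mod_cast h2
    omega
  rw [hk] at h
  simp only [Int.cast_zero, mul_zero] at h
  linarith

/-- If `a / b` is irrational, the integer combinations of `a` and `b` approximate every real. -/
lemma exists_int_combination_abs_sub_lt {a b : ℝ} (h : Irrational (a / b)) (w : ℝ) {ε : ℝ}
    (hε : 0 < ε) : ∃ k l : ℤ, |w - (k * a + l * b)| < ε := by
  obtain ⟨v, hv, hwv⟩ := Metric.dense_iff.mp (dense_addSubgroupClosure_pair_iff.mpr h) w ε hε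
  obtain ⟨k, l, rfl⟩ := AddSubgroup.mem_closure_pair.mp hwv
  refine ⟨k, l, ?_⟩
  rw [Metric.mem_ball', Real.dist_eq] at hv
  simpa using hv

/-- if the line `L_z` meets `Λ = αℤ×βℤ` only at the origin, then
`{tz mod Λ : t ∈ ℝ}` is dense in `[0,α) × [0,β)`. -/
theorem statement_18 (α β : ℝ) (hα : 0 < α) (hβ : 0 < β)
    (z : ℝ × ℝ) (hz : z ≠ 0)
    (hcap : {p : ℝ × ℝ | ∃ k l : ℤ, p = (α * k, β * l)}
        ∩ {p : ℝ × ℝ | ∃ t : ℝ, p = t • z} = {0})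
    (F : ℝ → ℝ × ℝ)
    (hF : ∀ t : ℝ, F t ∈ Set.Ico (0 : ℝ) α ×ˢ Set.Ico (0 : ℝ) β ∧
      t • z - F t ∈ {p : ℝ × ℝ | ∃ k l : ℤ, p = (α * k, β * l)}) :
    Set.Ico (0 : ℝ) α ×ˢ Set.Ico (0 : ℝ) β ⊆ closure (Set.range F) := by
  have hline : ∀ k l : ℤ, ∀ t : ℝ, (α * k, β * l) = t • z → k = 0 ∧ l = 0 := by
    intro k l t h
    have hmem : (α * k, β * l) ∈ ({0} : Set (ℝ × ℝ)) := hcap ▸ ⟨⟨k, l, rfl⟩, ⟨t, h⟩⟩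
    simpa [Prod.ext_iff, hα.ne', hβ.ne'] using hmem
  obtain ⟨z₁, z₂⟩ := z
  have hz₁ : z₁ ≠ 0 := by
    rintro rfl
    have hz₂ : z₂ ≠ 0 := fun h => hz (by simp [h])
    have := hline 0 1 (β / z₂) (by simp [hz₂])
    simp at this
  have hirr : Irrational (α * (z₂ / z₁) / β) := by
    rintro ⟨q, hq⟩
    have hden : (q.den : ℝ) ≠ 0 := by exact_mod_cast q.den_ne_zero
    rw [Rat.cast_def, div_eq_div_iff hden hβ.ne'] at hq
    have := (hline q.den q.num (α * q.den / z₁) (by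
      ext
      · simp [hz₁]
      · simp only [Prod.smul_mk, smul_eq_mul]
        linear_combination hq)).1
    exact q.den_ne_zero (by exact_mod_cast this)
  have hopen : Set.Ioo (0 : ℝ) α ×ˢ Set.Ioo (0 : ℝ) β ⊆ closure (Set.range F) := by
    rintro ⟨x, y⟩ ⟨⟨hx0, hxα⟩, hy0, hyβ⟩
    dsimp only at hx0 hxα hy0 hyβ
    rw [Metric.mem_closure_range_iff]
    intro ε hε
    obtain ⟨k, l, hkl⟩ := exists_int_combination_abs_sub_lt hirr (y - x * (z₂ / z₁))
      (lt_min hε (lt_min hy0 (sub_pos.mpr hyβ)))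
    rw [lt_min_iff, lt_min_iff] at hkl
    obtain ⟨hklε, hkl0, hklβ⟩ := hkl
    set y' : ℝ := x * (z₂ / z₁) + (k * (α * (z₂ / z₁)) + l * β) with hy'
    have hyy' : y - x * (z₂ / z₁) - (k * (α * (z₂ / z₁)) + l * β) = y - y' := by
      rw [hy']; ring
    rw [hyy'] at hklε hkl0 hklβ
    obtain ⟨⟨hF₁, hF₂⟩, m, n, hmn⟩ := hF ((x + α * k) / z₁)
    obtain ⟨hm, hn⟩ := Prod.ext_iff.mp hmn
    simp only [Prod.smul_mk, smul_eq_mul, Prod.fst_sub, Prod.snd_sub] at hm hn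
    rw [div_mul_cancel₀ _ hz₁] at hm
    have hfst : x = (F ((x + α * k) / z₁)).1 :=
      eq_of_mem_Ico_of_sub_eq_mul_int ⟨hx0.le, hxα⟩ hF₁ (k := m - k) (by
        push_cast
        linear_combination hm)
    have hsnd : y' = (F ((x + α * k) / z₁)).2 :=
      eq_of_mem_Ico_of_sub_eq_mul_int
        ⟨by linarith [(abs_lt.mp hkl0).2], by linarith [(abs_lt.mp hklβ).1]⟩ hF₂ (k := n + l) (by
          push_cast
          linear_combination hn)
    refine ⟨(x + α * k) / z₁, ?_⟩
    rw [Prod.dist_eq, ← hfst, ← hsnd, dist_self, Real.dist_eq]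
    exact max_lt hε hklε
  calc Set.Ico (0 : ℝ) α ×ˢ Set.Ico (0 : ℝ) β
      ⊆ closure (Set.Ioo (0 : ℝ) α ×ˢ Set.Ioo (0 : ℝ) β) := by
        rw [closure_prod_eq, closure_Ioo hα.ne, closure_Ioo hβ.ne]
        exact Set.prod_mono Set.Ico_subset_Icc_self Set.Ico_subset_Icc_self
    _ ⊆ closure (Set.range F) := closure_minimal hopen isClosed_closure

end
end

section
/- Let d ≥ 1, let Γ ⊆ ℝ^d, and let B ∈ ℝ^{d×d} be an invertible matrix. Then the lower Beurling densities satisfy D⁻(BΓ) = |det B|^{−1} · D⁻(Γ). -/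
open MeasureTheory Complex Filter
open scoped ENNReal InnerProductSpace RealInnerProductSpace ComplexConjugate

noncomputable section

/-- The lower Beurling density of a set `Γ ⊆ ℝ^d`, with values in `ℝ≥0∞`. -/
def lowerBeurlingDensity (d : ℕ) (Γ : Set (Fin d → ℝ)) : ℝ≥0∞ :=
  Filter.liminf (fun R : ℝ =>
    ⨅ x : Fin d → ℝ,
      ((Γ ∩ {y : Fin d → ℝ | ∀ i, x i - R ≤ y i ∧ y i ≤ x i + R}).encard : ℝ≥0∞) /
        (ENNReal.ofReal (2 * R)) ^ d) Filter.atTop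

lemma pi_box_eq_closedBall {d : ℕ} (x : Fin d → ℝ) {R : ℝ} (hR : 0 ≤ R) :
    {y : Fin d → ℝ | ∀ i, x i - R ≤ y i ∧ y i ≤ x i + R} = Metric.closedBall x R := by
  ext y
  rw [Metric.mem_closedBall, dist_pi_le_iff hR]
  refine forall_congr' fun i => ?_
  rw [Real.dist_eq, abs_le]
  constructor <;> rintro ⟨h₁, h₂⟩ <;> constructor <;> linarith

/-- Averaging estimate: a set meeting every cube of side `2r` in at least `c` points meets the
cubes of side `2R`, after applying `B`, in the corresponding proportion of points. -/
lemma mul_volume_le_encard_image_mul {d : ℕ} (Γ : Set (Fin d → ℝ))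
    (B : Matrix (Fin d) (Fin d) ℝ) (hB : IsUnit B.det) {M : ℝ}
    (hM : ∀ v, ‖B.mulVec v‖ ≤ M * ‖v‖) (hM0 : 0 ≤ M) {r R : ℝ} (hr : 0 < r) (hR : r * M ≤ R)
    {c : ℝ≥0∞} (hc : ∀ z, c ≤ ((Γ ∩ Metric.closedBall z r).encard : ℝ≥0∞)) (x : Fin d → ℝ) :
    c * (ENNReal.ofReal |B.det|⁻¹ * ENNReal.ofReal (2 * (R - r * M)) ^ d)
      ≤ ((((fun v => B.mulVec v) '' Γ) ∩ Metric.closedBall x R).encard : ℝ≥0∞)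
        * ENNReal.ofReal (2 * r) ^ d := by
  have hinj : Function.Injective (fun v => B.mulVec v) :=
    Matrix.mulVec_injective_iff_isUnit.2 ((Matrix.isUnit_iff_isUnit_det B).2 hB)
  set F : Set (Fin d → ℝ) := Γ ∩ (fun v => B.mulVec v) ⁻¹' Metric.closedBall x R with hF
  have hcard : (((fun v => B.mulVec v) '' Γ) ∩ Metric.closedBall x R).encard = F.encard := by
    rw [← Set.image_inter_preimage, hinj.encard_image]
  rw [hcard]
  by_cases hfin : F.Finite
  swap
  · have h0 : ENNReal.ofReal (2 * r) ^ d ≠ 0 :=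
      pow_ne_zero _ (by simpa using hr)
    rw [Set.Infinite.encard_eq hfin, ENat.toENNReal_top, ENNReal.top_mul h0]
    exact le_top
  set K : Set (Fin d → ℝ) := (Matrix.toLin' B) ⁻¹' Metric.closedBall x (R - r * M) with hK
  have hKvol : volume K
      = ENNReal.ofReal |B.det|⁻¹ * ENNReal.ofReal (2 * (R - r * M)) ^ d := by
    have hdet : LinearMap.det (Matrix.toLin' B) ≠ 0 := by
      rw [LinearMap.det_toLin']; exact hB.ne_zero
    rw [hK, Measure.addHaar_preimage_linearMap _ hdet, LinearMap.det_toLin', abs_inv,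
      Real.volume_pi_closedBall _ (by linarith), Fintype.card_fin,
      ENNReal.ofReal_pow (by linarith)]
  have hpt : ∀ z ∈ K, c ≤ ∑ g ∈ hfin.toFinset,
      (Metric.closedBall g r).indicator (fun _ => (1 : ℝ≥0∞)) z := by
    classical
    intro z hz
    refine (hc z).trans ?_
    have hsub : Γ ∩ Metric.closedBall z r
        ⊆ (hfin.toFinset.filter fun g => z ∈ Metric.closedBall g r : Finset _) := by
      rintro g ⟨hg, hgz⟩
      have hz' : dist (B.mulVec z) x ≤ R - r * M := by simpa [hK] using hz
      have hgz' : ‖g - z‖ ≤ r := by simpa [dist_eq_norm] using hgz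
      have hgz_image : dist (B.mulVec g) (B.mulVec z) ≤ r * M := by
        rw [dist_eq_norm, ← Matrix.mulVec_sub]
        calc _ ≤ M * ‖g - z‖ := hM _
          _ ≤ M * r := by gcongr
          _ = r * M := mul_comm _ _
      have : dist (B.mulVec g) x ≤ R :=
        (dist_triangle _ (B.mulVec z) _).trans (by linarith)
      simp only [Finset.coe_filter, Set.Finite.mem_toFinset, Set.mem_ofPred_eq, hF]
      exact ⟨⟨hg, this⟩, Metric.mem_closedBall_comm.1 hgz⟩
    have hle := Set.encard_le_encard hsub
    rw [Set.encard_coe_eq_coe_finsetCard] at hle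
    have hle' : ((Γ ∩ Metric.closedBall z r).encard : ℝ≥0∞)
        ≤ (((hfin.toFinset.filter fun g => z ∈ Metric.closedBall g r).card : ℕ∞) : ℝ≥0∞) :=
      ENat.toENNReal_le.2 hle
    refine hle'.trans (le_of_eq ?_)
    simp [Set.indicator_apply]
  calc _ = ∫⁻ _ in K, c := by rw [setLIntegral_const, hKvol]
    _ ≤ ∫⁻ z in K, ∑ g ∈ hfin.toFinset,
          (Metric.closedBall g r).indicator (fun _ => (1 : ℝ≥0∞)) z :=
        setLIntegral_mono (Finset.measurable_fun_sum _ fun g _ =>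
          measurable_const.indicator Metric.isClosed_closedBall.measurableSet) hpt
    _ ≤ ∫⁻ z, ∑ g ∈ hfin.toFinset,
          (Metric.closedBall g r).indicator (fun _ => (1 : ℝ≥0∞)) z :=
        setLIntegral_le_lintegral _ _
    _ = ∑ g ∈ hfin.toFinset, ENNReal.ofReal (2 * r) ^ d := by
        rw [lintegral_finsetSum _ fun g _ =>
          measurable_const.indicator Metric.isClosed_closedBall.measurableSet]
        refine Finset.sum_congr rfl fun g _ => ?_
        rw [lintegral_indicator Metric.isClosed_closedBall.measurableSet, setLIntegral_one,
          Real.volume_pi_closedBall _ hr.le, Fintype.card_fin, ENNReal.ofReal_pow (by linarith)]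
    _ = _ := by
        rw [Finset.sum_const, nsmul_eq_mul, hfin.encard_eq_coe_toFinset_card]
        simp

lemma lowerBeurlingDensity_le_image {d : ℕ} (Γ : Set (Fin d → ℝ))
    (B : Matrix (Fin d) (Fin d) ℝ) (hB : IsUnit B.det) :
    ENNReal.ofReal |B.det|⁻¹ * lowerBeurlingDensity d Γ
      ≤ lowerBeurlingDensity d ((fun x => B.mulVec x) '' Γ) := by
  have hdet0 : ENNReal.ofReal |B.det|⁻¹ ≠ 0 := by simpa using hB.ne_zero
  obtain ⟨M, hM0, hM⟩ : ∃ M : ℝ, 0 ≤ M ∧ ∀ v, ‖B.mulVec v‖ ≤ M * ‖v‖ :=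
    ⟨‖(Matrix.toLin' B).toContinuousLinearMap‖, norm_nonneg _,
      fun v => (Matrix.toLin' B).toContinuousLinearMap.le_opNorm v⟩
  rw [mul_comm, ← ENNReal.le_div_iff_mul_le (Or.inl hdet0) (Or.inl ENNReal.ofReal_ne_top)]
  refine (liminf_le_liminf (v := fun _ : ℝ => _) ?_).trans_eq (liminf_const _)
  filter_upwards [eventually_gt_atTop (0 : ℝ)] with r hr
  rw [ENNReal.le_div_iff_mul_le (Or.inl hdet0) (Or.inl ENNReal.ofReal_ne_top)]
  set m : ℝ≥0∞ := ⨅ x : Fin d → ℝ,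
      ((Γ ∩ {y : Fin d → ℝ | ∀ i, x i - r ≤ y i ∧ y i ≤ x i + r}).encard : ℝ≥0∞) /
        (ENNReal.ofReal (2 * r)) ^ d with hm
  have hr0 : ENNReal.ofReal (2 * r) ^ d ≠ 0 := pow_ne_zero _ (by simpa using hr)
  have hrt : ENNReal.ofReal (2 * r) ^ d ≠ ∞ := ENNReal.pow_ne_top ENNReal.ofReal_ne_top
  have hc : ∀ z, m * ENNReal.ofReal (2 * r) ^ d
      ≤ ((Γ ∩ Metric.closedBall z r).encard : ℝ≥0∞) := by
    intro z
    rw [← ENNReal.le_div_iff_mul_le (Or.inl hr0) (Or.inl hrt), ← pi_box_eq_closedBall z hr.le]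
    exact iInf_le _ z
  have hlim : Tendsto (fun R : ℝ => m * ENNReal.ofReal |B.det|⁻¹
      * ENNReal.ofReal (1 - r * M / R) ^ d) atTop
      (nhds (m * ENNReal.ofReal |B.det|⁻¹)) := by
    have h1 : Tendsto (fun R : ℝ => 1 - r * M / R) atTop (nhds 1) := by
      simpa using (tendsto_const_nhds (x := (1 : ℝ))).sub
        (tendsto_const_nhds (x := r * M) |>.div_atTop tendsto_id)
    have h2 : Tendsto (fun R : ℝ => ENNReal.ofReal (1 - r * M / R) ^ d) atTop (nhds 1) := by
      simpa using ENNReal.Tendsto.pow (n := d) (ENNReal.tendsto_ofReal h1)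
    simpa using ENNReal.Tendsto.const_mul (a := m * ENNReal.ofReal |B.det|⁻¹) h2
      (Or.inl one_ne_zero)
  rw [← hlim.liminf_eq]
  refine liminf_le_liminf ?_
  filter_upwards [eventually_gt_atTop (0 : ℝ), eventually_ge_atTop (r * M)] with R hR0 hR
  refine le_iInf fun x => ?_
  have hR0' : ENNReal.ofReal (2 * R) ^ d ≠ 0 := pow_ne_zero _ (by simpa using hR0)
  have hRt : ENNReal.ofReal (2 * R) ^ d ≠ ∞ := ENNReal.pow_ne_top ENNReal.ofReal_ne_top
  rw [pi_box_eq_closedBall x hR0.le, ENNReal.le_div_iff_mul_le (Or.inl hR0') (Or.inl hRt)]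
  have key := mul_volume_le_encard_image_mul Γ B hB hM hM0 hr hR hc x
  have hprod : ENNReal.ofReal (1 - r * M / R) ^ d * ENNReal.ofReal (2 * R) ^ d
      = ENNReal.ofReal (2 * (R - r * M)) ^ d := by
    rw [← mul_pow, ← ENNReal.ofReal_mul' (by linarith)]
    congr 2
    field_simp
  rw [← ENNReal.mul_le_mul_iff_left hr0 hrt]
  refine le_trans (le_of_eq ?_) key
  rw [← hprod]
  ring

/-- `D⁻(BΓ) = |det B|⁻¹ · D⁻(Γ)` for invertible `B`. -/
theorem statement_19 (d : ℕ) (hd : 1 ≤ d) (Γ : Set (Fin d → ℝ))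
    (B : Matrix (Fin d) (Fin d) ℝ) (hB : IsUnit B.det) :
    lowerBeurlingDensity d ((fun x => B.mulVec x) '' Γ)
      = ENNReal.ofReal |B.det|⁻¹ * lowerBeurlingDensity d Γ := by
  have hdet : 0 < |B.det|⁻¹ := inv_pos.2 (abs_pos.2 hB.ne_zero)
  refine le_antisymm ?_ (lowerBeurlingDensity_le_image Γ B hB)
  have hinv : IsUnit (B⁻¹).det := Matrix.isUnit_nonsing_inv_det B hB
  have h := lowerBeurlingDensity_le_image ((fun x => B.mulVec x) '' Γ) B⁻¹ hinv
  have himage : (fun x => (B⁻¹).mulVec x) '' ((fun x => B.mulVec x) '' Γ) = Γ := by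
    simp [Set.image_image, Matrix.mulVec_mulVec, Matrix.nonsing_inv_mul B hB]
  rw [himage, Matrix.det_nonsing_inv, Ring.inverse_eq_inv', abs_inv, inv_inv] at h
  calc lowerBeurlingDensity d ((fun x => B.mulVec x) '' Γ)
      = ENNReal.ofReal |B.det|⁻¹ * (ENNReal.ofReal |B.det|
          * lowerBeurlingDensity d ((fun x => B.mulVec x) '' Γ)) := by
        rw [← mul_assoc, ← ENNReal.ofReal_mul hdet.le,
          inv_mul_cancel₀ (abs_pos.2 hB.ne_zero).ne', ENNReal.ofReal_one, one_mul]
    _ ≤ _ := by gcongr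

end
end
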